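/- arXiv:1805.03238 — 2 statements merged into one kernel-verified Lean document; each statement's English description precedes it below -/
import Mathlib

section
/- For each prime power q and each positive integer k, there exists a sequence over F_q satisfying a linear recurrence of degree k (with c_0 ≠ 0) whose period is exactly q^k - 1. -/
open Polynomial IntermediateField in
/-- A generator of the unit group of a finite extension of finite fields is a primitive element. -/
theorem adjoin_eq_top_of_units_generator (F : Type*) {E : Type*} [Field F] [Field E] [Algebra F E]
    {u : Eˣ} (hu : ∀ x, x ∈ Subgroup.zpowers u) : F⟮(u : E)⟯ = ⊤ := by
  rw [eq_top_iff]
  rintro x -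
  by_cases hx : x = 0
  · exact hx ▸ zero_mem _
  · obtain ⟨n, hn⟩ := Subgroup.mem_zpowers_iff.mp (hu (Units.mk0 x hx))
    have h : x = (u : E) ^ n := by rw [← Units.val_zpow_eq_zpow_val, hn, Units.val_mk0]
    exact h ▸ zpow_mem (mem_adjoin_simple_self F (u : E)) n

open Polynomial in
/-- Powers of an integral element satisfy the recurrence given by its minimal polynomial. -/
theorem pow_add_natDegree_minpoly {F E : Type*} [Field F] [Field E] [Algebra F E] {x : E}
    (hx : IsIntegral F x) (n : ℕ) :
    x ^ (n + (minpoly F x).natDegree) =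
      ∑ i : Fin (minpoly F x).natDegree, (-(minpoly F x).coeff i) • x ^ (n + i.1) := by
  have h := minpoly.aeval F x
  rw [aeval_eq_sum_range, Finset.sum_range_succ, (minpoly.monic hx).coeff_natDegree, one_smul,
    Finset.sum_range] at h
  rw [pow_add, eq_neg_of_add_eq_zero_right h, mul_neg, Finset.mul_sum, ← Finset.sum_neg_distrib]
  refine Finset.sum_congr rfl fun i _ => ?_
  rw [pow_add, neg_smul, mul_smul_comm]

/-- A nonzero functional applied to the powers of a generator `u` of the unit group of a finite
field has the same periods as the powers of `u` themselves. -/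
theorem forall_map_pow_add_eq_iff {F E : Type*} [Field F] [Field E] [Finite E] [Algebra F E]
    {u : Eˣ} (hu : ∀ x, x ∈ Subgroup.zpowers u) {f : E →ₗ[F] F} (hf : f ≠ 0) (m : ℕ) :
    (∀ n : ℕ, f ((u : E) ^ (n + m)) = f ((u : E) ^ n)) ↔ u ^ m = 1 := by
  constructor
  · intro h
    by_contra hm
    have hne : (u : E) ^ m - 1 ≠ 0 := fun h0 =>
      hm (Units.ext (by simpa using sub_eq_zero.mp h0))
    refine hf (LinearMap.ext fun y => ?_)
    by_cases hy : y = 0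
    · simp [hy]
    obtain ⟨n, hn⟩ := mem_powers_iff_mem_zpowers.mpr
      (hu (Units.mk0 (y / ((u : E) ^ m - 1)) (div_ne_zero hy hne)))
    have hn' : (u : E) ^ n = y / ((u : E) ^ m - 1) := by
      simpa using congrArg Units.val hn
    have hy' : y = (u : E) ^ (n + m) - (u : E) ^ n := by
      rw [pow_add, ← mul_sub_one, hn', div_mul_cancel₀ _ hne]
    rw [hy', map_sub, h n, sub_self, LinearMap.zero_apply]
  · intro h n
    have h' : (u : E) ^ m = 1 := by simpa using congrArg Units.val h
    rw [pow_add, h', mul_one]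

/-- For each finite field `F_q` and each `k ≥ 1`, there is a sequence over `F_q`
satisfying a degree-`k` linear recurrence with `c 0 ≠ 0` whose period is exactly
`q ^ k - 1`. -/
theorem stmt_12 {F : Type*} [Field F] [Fintype F] (k : ℕ) (hk : 0 < k) :
    ∃ (c : Fin k → F) (a : ℕ → F),
      c ⟨0, hk⟩ ≠ 0 ∧
      (∀ n, a (n + k) = ∑ i : Fin k, c i * a (n + i.1)) ∧
      IsLeast {m : ℕ | 0 < m ∧ ∀ n : ℕ, a (n + m) = a n}
        (Fintype.card F ^ k - 1) := by
  obtain ⟨p, _⟩ := CharP.exists F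
  have : Fact p.Prime := ⟨CharP.char_is_prime F p⟩
  have : NeZero k := ⟨hk.ne'⟩
  obtain ⟨u, hu⟩ := IsCyclic.exists_generator (α := (FiniteField.Extension F p k)ˣ)
  have hint : IsIntegral F (u : FiniteField.Extension F p k) := IsIntegral.of_finite F _
  have hdeg : (minpoly F (u : FiniteField.Extension F p k)).natDegree = k :=
    ((Field.primitive_element_iff_minpoly_natDegree_eq F _).mp
      (adjoin_eq_top_of_units_generator F hu)).trans (FiniteField.finrank_extension F p k)
  have hord : orderOf u = Fintype.card F ^ k - 1 := by
    rw [orderOf_eq_card_of_forall_mem_zpowers hu, Nat.card_units, FiniteField.natCard_extension,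
      Nat.card_eq_fintype_card]
  have htr := Algebra.trace_ne_zero F (FiniteField.Extension F p k)
  refine ⟨fun i => -(minpoly F (u : FiniteField.Extension F p k)).coeff i,
    fun n => Algebra.trace F _ ((u : FiniteField.Extension F p k) ^ n),
    neg_ne_zero.mpr (minpoly.coeff_zero_ne_zero hint u.ne_zero), fun n => ?_, ?_⟩
  · have h := pow_add_natDegree_minpoly hint n
    rw [Fin.sum_univ_eq_sum_range (fun i => (-(minpoly F
      (u : FiniteField.Extension F p k)).coeff i) • (u : FiniteField.Extension F p k) ^ (n + i)),
      hdeg, Finset.sum_range] at h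
    simp only [h, map_sum, map_smul, smul_eq_mul]
  · simp only [forall_map_pow_add_eq_iff hu htr, ← hord]
    exact ⟨⟨orderOf_pos u, pow_orderOf_eq_one u⟩,
      fun m hm => orderOf_le_of_pow_eq_one hm.1 hm.2⟩
end

section
/- Let F_q have characteristic p ≥ 3. Then P(3, F_q) = D(q^3 - 1) ∪ D(q^2 - 1) ∪ p·D(q - 1); if p = 2, then P(3, F_q) = D(q^3 - 1) ∪ D(q^2 - 1) ∪ {2,4}·D(q - 1). -/
open Polynomial

/-- `m` is the least period of a sequence over `F` satisfying a linear recurrence of degree three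
with nonzero lowest coefficient. -/
def IsCubicRecurrencePeriod (F : Type*) [Field F] (m : ℕ) : Prop :=
  ∃ (c : Fin 3 → F) (a : ℕ → F),
    c 0 ≠ 0 ∧
    (∀ n, a (n + 3) = ∑ i : Fin 3, c i * a (n + i.1)) ∧
    IsLeast {m' : ℕ | 0 < m' ∧ ∀ n : ℕ, a (n + m') = a n} m

/-- The shift operator on sequences. -/
def shiftEnd (F : Type*) [Field F] : Module.End F (ℕ → F) :=
  LinearMap.funLeft F F (· + 1)

lemma Nat.sub_one_dvd_sq_sub_one (q : ℕ) : q - 1 ∣ q ^ 2 - 1 := by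
  simpa using Nat.sub_dvd_pow_sub_pow q 1 2

section Period

variable {F : Type*}

lemma isLeast_period_of_dvd {a : ℕ → F} {m : ℕ} (hm : 0 < m)
    (h : ∀ k, (∀ n, a (n + k) = a n) → m ∣ k) (hp : ∀ n, a (n + m) = a n) :
    IsLeast {k : ℕ | 0 < k ∧ ∀ n : ℕ, a (n + k) = a n} m :=
  ⟨⟨hm, hp⟩, fun _ hk ↦ Nat.le_of_dvd hk.1 (h _ hk.2)⟩

lemma IsLeast.period_dvd {a : ℕ → F} {m N : ℕ}
    (hm : IsLeast {k : ℕ | 0 < k ∧ ∀ n : ℕ, a (n + k) = a n} m)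
    (hN : ∀ n, a (n + N) = a n) : m ∣ N := by
  have hmul (j n : ℕ) : a (n + m * j) = a n := by
    induction j with
    | zero => simp
    | succ j ih => rw [mul_add, mul_one, ← add_assoc, hm.1.2, ih]
  rw [Nat.dvd_iff_mod_eq_zero]
  by_contra h
  refine (Nat.mod_lt N hm.1.1).not_ge (hm.2 ⟨Nat.pos_of_ne_zero h, fun n ↦ ?_⟩)
  rw [← hmul (N / m) (n + N % m), add_assoc, Nat.mod_add_div, hN]

end Period

section Field

variable {F : Type*} [Field F]

lemma shiftEnd_pow_apply (k : ℕ) (a : ℕ → F) (n : ℕ) :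
    (shiftEnd F ^ k) a n = a (n + k) := by
  induction k generalizing a with
  | zero => simp
  | succ k ih =>
    rw [pow_succ, Module.End.mul_apply, ih]
    simp [shiftEnd, LinearMap.funLeft_apply, add_assoc]

/-- A period is controlled by any `X ^ N - 1` divisible by the characteristic polynomial. -/
lemma IsCubicRecurrencePeriod.exists_polynomial {m : ℕ} (h : IsCubicRecurrencePeriod F m) :
    0 < m ∧ ∃ f : F[X], f.Monic ∧ f.natDegree = 3 ∧ f.coeff 0 ≠ 0 ∧
      ∀ N, f ∣ X ^ N - 1 → m ∣ N := by
  obtain ⟨c, a, hc, ha, hm⟩ := h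
  refine ⟨hm.1.1, X ^ 3 - (C (c 2) * X ^ 2 + C (c 1) * X + C (c 0)), ?_, ?_, ?_, ?_⟩
  · monicity!
  · compute_degree!
  · simpa using hc
  · rintro N ⟨g, hg⟩
    refine hm.period_dvd fun n ↦ ?_
    have h0 : aeval (shiftEnd F) (X ^ 3 - (C (c 2) * X ^ 2 + C (c 1) * X + C (c 0)) : F[X]) a
        = 0 := by
      funext n
      have h1 := shiftEnd_pow_apply 1 a
      rw [pow_one] at h1
      simp [shiftEnd_pow_apply, h1, ha, Fin.sum_univ_three]
      ring
    have h1 : aeval (shiftEnd F) (X ^ N - 1 : F[X]) a = 0 := by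
      rw [hg, mul_comm, map_mul, Module.End.mul_apply, h0, map_zero]
    have h2 := congrFun h1 n
    simpa [shiftEnd_pow_apply, sub_eq_zero] using h2

lemma exists_cubic_of_aeval_eq_zero {K : Type*} [Field K] [Algebra F K] {α : K} (hα : α ≠ 0)
    [FiniteDimensional F K] (hK : Module.finrank F K ≤ 3) :
    ∃ f : F[X], f.Monic ∧ f.natDegree = 3 ∧ f.coeff 0 ≠ 0 ∧ aeval α f = 0 := by
  have hint : IsIntegral F α := IsIntegral.of_finite F α
  have hmon := minpoly.monic hint
  have hmon' : (X - C 1 : F[X]).Monic := monic_X_sub_C 1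
  refine ⟨minpoly F α * (X - C 1) ^ (3 - (minpoly F α).natDegree), hmon.mul (hmon'.pow _),
    ?_, ?_, ?_⟩
  · rw [hmon.natDegree_mul (hmon'.pow _), hmon'.natDegree_pow, natDegree_X_sub_C]
    have := minpoly.natDegree_le (A := F) α
    omega
  · rw [mul_coeff_zero]
    refine mul_ne_zero (minpoly.coeff_zero_ne_zero hint hα) ?_
    rw [coeff_zero_eq_eval_zero]
    simp
  · simp

lemma isCubicRecurrencePeriod_orderOf {K : Type*} [Field K] [Algebra F K] [FiniteDimensional F K]
    (hK : Module.finrank F K ≤ 3) {α : K} (hα : 0 < orderOf α) :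
    IsCubicRecurrencePeriod F (orderOf α) := by
  have hα0 : α ≠ 0 := by
    rintro rfl
    simp at hα
  obtain ⟨f, hf, hdeg, hf0, hroot⟩ := exists_cubic_of_aeval_eq_zero (F := F) hα0 hK
  obtain ⟨l, hl⟩ : ∃ l : Module.Dual F K, l 1 ≠ 0 := by
    by_contra! h
    exact one_ne_zero ((Module.forall_dual_apply_eq_zero_iff F (1 : K)).1 h)
  have hsum : α ^ 3 + f.coeff 2 • α ^ 2 + f.coeff 1 • α + f.coeff 0 • 1 = 0 := by
    have h3 : f.coeff 3 = 1 := hdeg ▸ hf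
    rw [aeval_eq_sum_range, hdeg] at hroot
    simp only [Finset.sum_range_succ, Finset.sum_range_zero, h3, pow_zero, pow_one, one_smul]
      at hroot
    linear_combination hroot
  refine ⟨fun i ↦ -f.coeff i, fun n ↦ l (α ^ n), by simpa using hf0, fun n ↦ ?_,
    isLeast_period_of_dvd (a := fun n ↦ l (α ^ n))
      hα (fun k hk ↦ ?_) fun n ↦ ?_⟩
  · have h : α ^ (n + 3) = -(f.coeff 2 • α ^ (n + 2)) - f.coeff 1 • α ^ (n + 1)
        - f.coeff 0 • α ^ n := by
      simp only [Algebra.smul_def] at hsum ⊢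
      linear_combination α ^ n * hsum
    simp only [h, map_sub, map_neg, map_smul, smul_eq_mul, Fin.sum_univ_three, Fin.val_zero,
      Fin.val_one, Fin.val_two, add_zero]
    ring
  · rw [orderOf_dvd_iff_pow_eq_one]
    by_contra hne
    have hβ : α ^ k - 1 ≠ 0 := sub_ne_zero.2 hne
    have hvan (p : F[X]) : l (aeval α p * (α ^ k - 1)) = 0 := by
      induction p using Polynomial.induction_on' with
      | add p q hp hq => rw [map_add, add_mul, map_add, hp, hq, add_zero]
      | monomial n r =>
        rw [aeval_monomial, ← Algebra.smul_def, smul_mul_assoc, map_smul, mul_sub, ← pow_add,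
          mul_one, map_sub, hk, sub_self, smul_zero]
    have hmem : α ^ k - 1 ∈ Algebra.adjoin F {α} :=
      sub_mem (pow_mem (Algebra.self_mem_adjoin_singleton F α) k) (one_mem _)
    have hinv : (α ^ k - 1)⁻¹ ∈ Algebra.adjoin F {α} :=
      (Algebra.adjoin F {α}).inv_mem_of_algebraic (x := ⟨_, hmem⟩)
        (Algebra.IsAlgebraic.isAlgebraic _)
    rw [Algebra.adjoin_singleton_eq_range_aeval] at hinv
    obtain ⟨p, hp⟩ := hinv
    have h := hvan p
    rw [show aeval α p = (α ^ k - 1)⁻¹ from hp, inv_mul_cancel₀ hβ] at h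
    exact hl h
  · rw [pow_add, pow_orderOf_eq_one, mul_one]

/-- The sequence `n * α ^ n`. -/
lemma isCubicRecurrencePeriod_ringChar_mul {α : F} (hα : 0 < orderOf α) (hp : ringChar F ≠ 0)
    (hcop : (ringChar F).Coprime (orderOf α)) :
    IsCubicRecurrencePeriod F (ringChar F * orderOf α) := by
  have hα0 : α ≠ 0 := by
    rintro rfl
    simp at hα
  refine ⟨![α ^ 2, -(α ^ 2 + 2 * α), 2 * α + 1], fun n ↦ n * α ^ n, by simpa using hα0,
    fun n ↦ ?_, isLeast_period_of_dvd (a := fun n ↦ n * α ^ n)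
      (by positivity) (fun k hk ↦ ?_) fun n ↦ ?_⟩
  · simp [Fin.sum_univ_three]
    ring
  · have h0 : (k : F) = 0 := by simpa [hα0] using hk 0
    have h1 : α ^ k = 1 := by
      have := hk 1
      simp only [Nat.cast_add, h0, add_zero, pow_add, Nat.cast_one] at this
      simpa [hα0] using this
    exact hcop.mul_dvd_of_dvd_of_dvd (ringChar.dvd h0) (orderOf_dvd_of_pow_eq_one h1)
  · simp [pow_add, pow_mul, mul_comm (ringChar F), pow_orderOf_eq_one]

/-- The sequence `n.choose 2 * α ^ n`. -/
lemma isCubicRecurrencePeriod_four_mul {α : F} (hα : 0 < orderOf α) (hp : ringChar F = 2)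
    (hcop : Nat.Coprime 2 (orderOf α)) :
    IsCubicRecurrencePeriod F (4 * orderOf α) := by
  have hα0 : α ≠ 0 := by
    rintro rfl
    simp at hα
  have hdvd {k : ℕ} : (k : F) = 0 ↔ 2 ∣ k := hp ▸ ringChar.spec F k
  have h2 : (2 : F) = 0 := by exact_mod_cast hdvd.2 dvd_rfl
  have hch (n : ℕ) : ((n + 1).choose 2 : F) = n + n.choose 2 := by
    rw [Nat.choose_succ_succ' n 1, Nat.choose_one_right, Nat.cast_add]
  refine ⟨![α ^ 3, -(3 * α ^ 2), 3 * α], fun n ↦ n.choose 2 * α ^ n, by simpa using hα0,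
    fun n ↦ ?_, isLeast_period_of_dvd (a := fun n ↦ n.choose 2 * α ^ n)
      (by positivity) (fun k hk ↦ ?_) fun n ↦ ?_⟩
  · simp [Fin.sum_univ_three, hch]
    ring
  · have hc0 : (k.choose 2 : F) = 0 := by simpa [hα0] using hk 0
    have hk0 : (k : F) = 0 := by
      have := hk 1
      simpa [add_comm 1 k, hch, hc0, hα0] using this
    have h1 : α ^ k = 1 := by
      have := hk 2
      simpa [add_comm 2 k, hch, hc0, hk0, hα0, pow_add] using this
    obtain ⟨j, rfl⟩ := hdvd.1 hk0
    have h4 : 2 ∣ j := by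
      have h := hdvd.1 hc0
      rw [Nat.choose_two_right, mul_assoc, Nat.mul_div_cancel_left _ two_pos] at h
      rcases Nat.prime_two.dvd_mul.1 h with h | h <;> omega
    refine Nat.Coprime.mul_dvd_of_dvd_of_dvd (hcop.pow_left 2) ?_ (orderOf_dvd_of_pow_eq_one h1)
    omega
  · have h4 (n : ℕ) : ((n + 4).choose 2 : F) = n.choose 2 := by
      simp only [show n + 4 = n + 1 + 1 + 1 + 1 from rfl, hch, Nat.cast_add, Nat.cast_one]
      linear_combination (2 * (n : F) + 3) * h2
    have hper (j : ℕ) : ((n + 4 * j).choose 2 : F) = n.choose 2 := by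
      induction j with
      | zero => simp
      | succ j ih => rw [mul_add, mul_one, ← add_assoc, h4, ih]
    rw [hper, pow_add, mul_comm 4, pow_mul, pow_orderOf_eq_one, one_pow, mul_one]

end Field

section Finite

variable {F : Type*} [Field F] [Fintype F]

lemma dvd_X_pow_card_pow_sub_one {f : F[X]} (hf : Irreducible f) (h0 : f.coeff 0 ≠ 0) {k : ℕ}
    (hk : f.natDegree ∣ k) : f ∣ X ^ (Fintype.card F ^ k - 1) - 1 := by
  have h := (hf.natDegree_dvd_iff_dvd_X_pow_card_pow_sub_X (n := k)).1 hk
  rw [Nat.card_eq_fintype_card] at h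
  have hpos : 0 < Fintype.card F ^ k := pow_pos Fintype.card_pos k
  have hfac : (X ^ Fintype.card F ^ k - X : F[X]) = X * (X ^ (Fintype.card F ^ k - 1) - 1) := by
    rw [mul_sub, ← pow_succ', Nat.sub_add_cancel hpos, mul_one]
  rw [hfac] at h
  exact (hf.prime.dvd_or_dvd h).resolve_left fun hX ↦
    h0 (X_dvd_iff.1 (hf.associated_of_dvd irreducible_X hX).symm.dvd)

lemma exists_orderOf_eq (K : Type*) [Field K] [Finite K] {d : ℕ} (hd : d ∣ Nat.card K - 1) :
    ∃ α : K, orderOf α = d ∧ 0 < orderOf α := by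
  obtain ⟨g, hg⟩ := IsCyclic.exists_ofOrder_eq_natCard (α := Kˣ)
  rw [Nat.card_units] at hg
  have hpos : 0 < Nat.card K - 1 := Nat.sub_pos_of_lt Finite.one_lt_card
  have h := orderOf_pow_orderOf_div (x := g) (n := d) (by omega) (hg ▸ hd)
  refine ⟨((g ^ (orderOf g / d) : Kˣ) : K), ?_, ?_⟩
  · rw [orderOf_units, h]
  · rw [orderOf_units, h]
    exact Nat.pos_of_dvd_of_pos hd hpos

lemma isCubicRecurrencePeriod_of_dvd {k d : ℕ} (hk : k ≠ 0) (hk3 : k ≤ 3)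
    (hd : d ∣ Fintype.card F ^ k - 1) : IsCubicRecurrencePeriod F d := by
  have : NeZero k := ⟨hk⟩
  have : Fact (ringChar F).Prime := ⟨CharP.char_is_prime F _⟩
  obtain ⟨α, rfl, hα⟩ := exists_orderOf_eq (FiniteField.Extension F (ringChar F) k) (d := d)
    (by rwa [FiniteField.natCard_extension, Nat.card_eq_fintype_card])
  exact isCubicRecurrencePeriod_orderOf
    ((FiniteField.finrank_extension F (ringChar F) k).trans_le hk3) hα

lemma coprime_ringChar_of_dvd {d : ℕ} (hd : d ∣ Fintype.card F - 1) :
    (ringChar F).Coprime d := by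
  obtain ⟨n, hp, hn⟩ := FiniteField.card F (ringChar F)
  refine (Nat.Prime.coprime_iff_not_dvd hp).2 fun h ↦ hp.one_lt.ne' ?_
  have h1 : ringChar F ∣ Fintype.card F := hn ▸ dvd_pow_self _ n.ne_zero
  have h2 := (Nat.dvd_sub_iff_right Fintype.card_pos h1).1 (h.trans hd)
  exact Nat.dvd_one.1 h2

/-- Every polynomial of degree three over `F` with nonzero constant term divides one of
`X ^ (q ^ 3 - 1) - 1`, `X ^ (q ^ 2 - 1) - 1` and `(X ^ (q - 1) - 1) ^ 3`. -/
lemma cubic_dvd_cases {f : F[X]} (hf : f.Monic) (hdeg : f.natDegree = 3) (h0 : f.coeff 0 ≠ 0) :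
    f ∣ X ^ (Fintype.card F ^ 3 - 1) - 1 ∨ f ∣ X ^ (Fintype.card F ^ 2 - 1) - 1 ∨
      f ∣ (X ^ (Fintype.card F - 1) - 1) ^ 3 := by
  have hlin {a : F} (h : (X - C a).coeff 0 ≠ 0) {k : ℕ} :
      X - C a ∣ X ^ (Fintype.card F ^ k - 1) - 1 :=
    dvd_X_pow_card_pow_sub_one (irreducible_X_sub_C a) h (by simp)
  have hlin1 {a : F} (h : (X - C a).coeff 0 ≠ 0) : X - C a ∣ X ^ (Fintype.card F - 1) - 1 := by
    simpa using hlin h (k := 1)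
  by_cases hirr : Irreducible f
  · exact .inl (dvd_X_pow_card_pow_sub_one hirr h0 hdeg.dvd)
  obtain ⟨a, ha⟩ : ∃ a, f.IsRoot a := by
    by_contra! h
    exact hirr (irreducible_of_degree_le_three_of_not_isRoot (by simp [hdeg]) h)
  obtain ⟨g, rfl⟩ := dvd_iff_isRoot.2 ha
  have hg : g.Monic := (monic_X_sub_C a).of_mul_monic_left hf
  rw [(monic_X_sub_C a).natDegree_mul hg, natDegree_X_sub_C] at hdeg
  have hgdeg : g.natDegree = 2 := by omega
  rw [mul_coeff_zero] at h0
  have ha0 := left_ne_zero_of_mul h0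
  have hg0 := right_ne_zero_of_mul h0
  by_cases hgirr : Irreducible g
  · refine .inr (.inl (IsCoprime.mul_dvd ?_ (hlin ha0)
      (dvd_X_pow_card_pow_sub_one hgirr hg0 hgdeg.dvd)))
    refine ((irreducible_X_sub_C a).coprime_iff_not_dvd).2 fun h ↦ ?_
    have := natDegree_eq_natDegree
      (degree_eq_degree_of_associated ((irreducible_X_sub_C a).associated_of_dvd hgirr h))
    rw [natDegree_X_sub_C] at this
    omega
  obtain ⟨b, hb⟩ : ∃ b, g.IsRoot b := by
    by_contra! h
    exact hgirr (irreducible_of_degree_le_three_of_not_isRoot (by simp [hgdeg]) h)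
  obtain ⟨e, rfl⟩ := dvd_iff_isRoot.2 hb
  have he : e.Monic := (monic_X_sub_C b).of_mul_monic_left hg
  rw [(monic_X_sub_C b).natDegree_mul he, natDegree_X_sub_C] at hgdeg
  rw [mul_coeff_zero] at hg0
  have hee : e = X - C (-e.coeff 0) := by
    rw [he.as_sum, show e.natDegree = 1 by omega]
    simp
  have he1 := right_ne_zero_of_mul hg0
  rw [hee] at he1
  refine .inr (.inr ?_)
  rw [pow_succ', pow_two, hee]
  exact mul_dvd_mul (hlin1 ha0) (mul_dvd_mul (hlin1 (left_ne_zero_of_mul hg0)) (hlin1 he1))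

lemma IsCubicRecurrencePeriod.dvd_cases {m : ℕ} (h : IsCubicRecurrencePeriod F m) {e : ℕ}
    (he : 3 ≤ ringChar F ^ e) :
    m ∣ Fintype.card F ^ 3 - 1 ∨ m ∣ Fintype.card F ^ 2 - 1 ∨
      m ∣ ringChar F ^ e * (Fintype.card F - 1) := by
  obtain ⟨-, f, hf, hdeg, h0, hdvd⟩ := h.exists_polynomial
  have : Fact (ringChar F).Prime := ⟨CharP.char_is_prime F _⟩
  refine (cubic_dvd_cases hf hdeg h0).imp (hdvd _) (Or.imp (hdvd _) fun h3 ↦ hdvd _ ?_)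
  have h4 := h3.trans (pow_dvd_pow _ he)
  rwa [sub_pow_char_pow, one_pow, ← pow_mul, mul_comm] at h4

end Finite


/-- `P(3, F_q) = D(q^3-1) ∪ D(q^2-1) ∪ p·D(q-1)` when the characteristic `p ≥ 3`,
and `P(3, F_q) = D(q^3-1) ∪ D(q^2-1) ∪ {2,4}·D(q-1)` when `p = 2`. -/
theorem stmt_18 {F : Type*} [Field F] [Fintype F] :
    (3 ≤ ringChar F →
      {m : ℕ | ∃ (c : Fin 3 → F) (a : ℕ → F),
          c 0 ≠ 0 ∧
          (∀ n, a (n + 3) = ∑ i : Fin 3, c i * a (n + i.1)) ∧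
          IsLeast {m' : ℕ | 0 < m' ∧ ∀ n : ℕ, a (n + m') = a n} m}
        =
      {n : ℕ | n ∣ Fintype.card F ^ 3 - 1} ∪
        {n : ℕ | n ∣ Fintype.card F ^ 2 - 1} ∪
        {n : ℕ | ∃ d : ℕ, d ∣ Fintype.card F - 1 ∧ n = ringChar F * d}) ∧
    (ringChar F = 2 →
      {m : ℕ | ∃ (c : Fin 3 → F) (a : ℕ → F),
          c 0 ≠ 0 ∧
          (∀ n, a (n + 3) = ∑ i : Fin 3, c i * a (n + i.1)) ∧
          IsLeast {m' : ℕ | 0 < m' ∧ ∀ n : ℕ, a (n + m') = a n} m}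
        =
      {n : ℕ | n ∣ Fintype.card F ^ 3 - 1} ∪
        {n : ℕ | n ∣ Fintype.card F ^ 2 - 1} ∪
        {n : ℕ | ∃ d : ℕ, d ∣ Fintype.card F - 1 ∧ (n = 2 * d ∨ n = 4 * d)}) := by
  constructor
  · intro hp
    ext m
    change IsCubicRecurrencePeriod F m ↔ (_ ∨ _) ∨ _
    constructor
    · intro h
      rcases h.dvd_cases (e := 1) (by simpa using hp) with h | h | h
      · exact .inl (.inl h)
      · exact .inl (.inr h)
      · rw [pow_one, Nat.dvd_mul] at h
        obtain ⟨x, d, hx, hd, rfl⟩ := h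
        rcases (Nat.dvd_prime (CharP.char_is_prime F _)).1 hx with rfl | rfl
        · exact .inl (.inr (by simpa using hd.trans (Nat.sub_one_dvd_sq_sub_one _)))
        · exact .inr ⟨d, hd, rfl⟩
    · rintro ((h | h) | ⟨d, hd, rfl⟩)
      · exact isCubicRecurrencePeriod_of_dvd three_ne_zero le_rfl h
      · exact isCubicRecurrencePeriod_of_dvd two_ne_zero (by norm_num) h
      · obtain ⟨α, rfl, hα⟩ := exists_orderOf_eq F (d := d) (by simpa using hd)
        exact isCubicRecurrencePeriod_ringChar_mul hα (by omega) (coprime_ringChar_of_dvd hd)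
  · intro hp
    ext m
    change IsCubicRecurrencePeriod F m ↔ (_ ∨ _) ∨ _
    constructor
    · intro h
      rcases h.dvd_cases (e := 2) (by simp [hp]) with h | h | h
      · exact .inl (.inl h)
      · exact .inl (.inr h)
      · rw [Nat.dvd_mul] at h
        obtain ⟨x, d, hx, hd, rfl⟩ := h
        rw [hp] at hx
        obtain ⟨i, hi, rfl⟩ := (Nat.dvd_prime_pow Nat.prime_two).1 hx
        interval_cases i
        · exact .inl (.inr (by simpa using hd.trans (Nat.sub_one_dvd_sq_sub_one _)))
        · exact .inr ⟨d, hd, .inl rfl⟩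
        · exact .inr ⟨d, hd, .inr rfl⟩
    · rintro ((h | h) | ⟨d, hd, rfl | rfl⟩)
      · exact isCubicRecurrencePeriod_of_dvd three_ne_zero le_rfl h
      · exact isCubicRecurrencePeriod_of_dvd two_ne_zero (by norm_num) h
      · obtain ⟨α, rfl, hα⟩ := exists_orderOf_eq F (d := d) (by simpa using hd)
        rw [← hp]
        exact isCubicRecurrencePeriod_ringChar_mul hα (by omega) (coprime_ringChar_of_dvd hd)
      · obtain ⟨α, rfl, hα⟩ := exists_orderOf_eq F (d := d) (by simpa using hd)
        exact isCubicRecurrencePeriod_four_mul hα hp (hp ▸ coprime_ringChar_of_dvd hd)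
end
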